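/- Let M, M′ be nonnegative integers, let r_1,…,r_M and r′_1,…,r′_{M′} be positive integers, let s be a nonnegative integer, and set k = s + ∑_{j=1}^M r_j + ∑_{j′=1}^{M′} r′_{j′}. Then ∑_{n=1}^∞ [∏_{j=1}^M H_{n-1}^{(r_j)}] · [∏_{j′=1}^{M′} (H_{2n-1}^{(r′_{j′})} + H̄_{2n-1}^{(r′_{j′})})] / n^{s+2} belongs to 𝔷_{k+2}(2), and ∑_{n=1}^∞ (-1)^n [∏_{j=1}^M H_{n-1}^{(r_j)}] · [∏_{j′=1}^{M′} (H_{2n-1}^{(r′_{j′})} + H̄_{2n-1}^{(r′_{j′})})] / n^{s+1} belongs to 𝔷_{k+1}(4). -/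

import Mathlib

open scoped Real
open MeasureTheory

noncomputable section

/-- Goncharov's multiple polylogarithm. -/
def MPL {n : ℕ} (a : Fin n → ℕ) (z : Fin n → ℂ) : ℂ :=
  ∑' ℓ : {f : Fin n → ℕ // StrictAnti f ∧ ∀ i, 0 < f i},
    ∏ j, z j ^ (ℓ.1 j) / ((ℓ.1 j : ℂ) ^ (a j))

/-- `x` is a (convergent) multiple polylogarithm value of weight `k` at `N`-th roots of unity. -/
def IsCMZV (k N : ℕ) (x : ℂ) : Prop :=
  ∃ (n : ℕ) (a : Fin (n + 1) → ℕ) (z : Fin (n + 1) → ℂ),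
    (∀ j, 0 < a j) ∧ (∀ j, z j ^ N = 1) ∧ (∑ j, a j = k) ∧
    ¬(a 0 = 1 ∧ z 0 = 1) ∧ x = MPL a z

/-- The ℚ-vector space `𝔷_k(N)`. -/
def zspan (k N : ℕ) : Submodule ℚ ℂ := Submodule.span ℚ {x | IsCMZV k N x}

/-- Harmonic number of order `r`: `H_n^{(r)} = ∑_{k=1}^n 1/k^r`. -/
def H (r n : ℕ) : ℝ := ∑ k ∈ Finset.range n, (1 : ℝ) / (k + 1) ^ r

/-- Alternating harmonic number of order `r`: `H̄_n^{(r)} = ∑_{k=1}^n (-1)^{k-1}/k^r`. -/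
def Hbar (r n : ℕ) : ℝ := ∑ k ∈ Finset.range n, (-1 : ℝ) ^ k / (k + 1) ^ r

lemma strictAnti_cons_iff' {n : ℕ} (m : ℕ) (g : Fin n → ℕ) :
    StrictAnti (Fin.cons m g : Fin (n + 1) → ℕ) ↔ (∀ i, g i < m) ∧ StrictAnti g := by
  constructor
  · intro h
    refine ⟨fun i => ?_, fun i j hij => ?_⟩
    · have := h (Fin.succ_pos i)
      simpa using this
    · have := h (Fin.succ_lt_succ_iff.mpr hij)
      simpa using this
  · rintro ⟨h1, h2⟩ i j hij
    induction i using Fin.cases with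
    | zero =>
      induction j using Fin.cases with
      | zero => exact absurd hij (lt_irrefl _)
      | succ j => simpa using h1 j
    | succ i =>
      induction j using Fin.cases with
      | zero => exact absurd hij (by simp)
      | succ j => simpa using h2 (Fin.succ_lt_succ_iff.mp hij)

/-- One letter. -/
def ltr (a : ℕ) (z : ℂ) (l : ℕ) : ℂ := z ^ l / (l : ℂ) ^ a

open Classical in
/-- Truncated summand. -/
def UU {n : ℕ} (a : Fin n → ℕ) (z : Fin n → ℂ) (m : ℕ) (f : Fin n → ℕ) : ℂ :=
  if (∀ i, f i < m) ∧ StrictAnti f then ∏ j, ltr (a j) (z j) (f j) else 0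

open Classical in
/-- Full summand. -/
def VV {n : ℕ} (a : Fin n → ℕ) (z : Fin n → ℂ) (f : Fin n → ℕ) : ℂ :=
  if StrictAnti f then ∏ j, ltr (a j) (z j) (f j) else 0

lemma VV_cons {n : ℕ} (a0 : ℕ) (z0 : ℂ) (a : Fin n → ℕ) (z : Fin n → ℂ) (l : ℕ)
    (g : Fin n → ℕ) :
    VV (Fin.cons a0 a) (Fin.cons z0 z) (Fin.cons l g) = ltr a0 z0 l * UU a z l g := by
  unfold VV UU
  simp only [strictAnti_cons_iff', Fin.prod_univ_succ, Fin.cons_zero, Fin.cons_succ]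
  split_ifs <;> simp

lemma UU_cons {n : ℕ} (a0 : ℕ) (z0 : ℂ) (a : Fin n → ℕ) (z : Fin n → ℂ) (m l : ℕ)
    (g : Fin n → ℕ) :
    UU (Fin.cons a0 a) (Fin.cons z0 z) m (Fin.cons l g) =
      if l < m then ltr a0 z0 l * UU a z l g else 0 := by
  unfold UU
  simp only [strictAnti_cons_iff', Fin.prod_univ_succ, Fin.cons_zero, Fin.cons_succ,
    Fin.forall_fin_succ]
  by_cases h : l < m
  · by_cases h2 : (∀ i, g i < l) ∧ StrictAnti g
    · have : ∀ i, g i < m := fun i => (h2.1 i).trans h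
      simp [h, h2, this]
    · rw [if_neg (fun h3 => h2 h3.2), if_pos h, if_neg h2, mul_zero]
  · rw [if_neg (fun h3 => h h3.1.1), if_neg h]

lemma MPL_eq {n : ℕ} (a : Fin n → ℕ) (z : Fin n → ℂ) (ha : ∀ j, 0 < a j) :
    MPL a z = ∑' f, VV a z f := by
  unfold MPL
  have := tsum_subtype {f : Fin n → ℕ | StrictAnti f ∧ ∀ i, 0 < f i}
    (fun f => ∏ j, z j ^ (f j) / ((f j : ℂ) ^ (a j)))
  refine this.trans (tsum_congr fun f => ?_)
  unfold VV ltr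
  by_cases h : StrictAnti f
  · by_cases h2 : ∀ i, 0 < f i
    · rw [Set.indicator_of_mem (show f ∈ {f : Fin n → ℕ | StrictAnti f ∧ ∀ i, 0 < f i} from ⟨h, h2⟩),
        if_pos h]
    · rw [Set.indicator_of_notMem (fun h3 => h2 h3.2), if_pos h]
      push Not at h2
      obtain ⟨i, hi⟩ := h2
      refine (Finset.prod_eq_zero (Finset.mem_univ i) ?_).symm
      have : f i = 0 := by omega
      simp [this, (ha i).ne']
  · rw [Set.indicator_of_notMem (fun h3 => h h3.1), if_neg h]

lemma UU_support {n : ℕ} (a : Fin n → ℕ) (z : Fin n → ℂ) (m : ℕ) :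
    (Function.support (UU a z m)).Finite := by
  refine (Finset.finite_toSet (Fintype.piFinset fun _ : Fin n => Finset.range m)).subset ?_
  intro f hf
  by_contra h
  apply hf
  unfold UU
  rw [if_neg]
  rintro ⟨h1, -⟩
  apply h
  simpa using h1

/-- Summation operator. -/
def Iop (a : ℕ) (z : ℂ) : (ℕ → ℂ) →ₗ[ℚ] (ℕ → ℂ) where
  toFun f m := ∑ l ∈ Finset.range m, ltr a z l * f l
  map_add' f g := by
    ext m; simp [mul_add, Finset.sum_add_distrib]
  map_smul' c f := by
    ext m; simp [Finset.smul_sum]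

lemma Iop_apply (a : ℕ) (z : ℂ) (f : ℕ → ℂ) (m : ℕ) :
    Iop a z f m = ∑ l ∈ Finset.range m, ltr a z l * f l := rfl

/-- Truncated sums. -/
inductive Gen (N : ℕ) : ℕ → (ℕ → ℂ) → Prop
  | one : Gen N 0 1
  | cons (a k : ℕ) (z : ℂ) (f : ℕ → ℂ) (ha : 0 < a) (hz : z ^ N = 1) (hf : Gen N k f) :
      Gen N (a + k) (Iop a z f)

def TT (N k : ℕ) : Submodule ℚ (ℕ → ℂ) := Submodule.span ℚ {f | Gen N k f}

def harm (m : ℕ) : ℝ := ∑ l ∈ Finset.range m, 1 / (l : ℝ)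

lemma harm_nonneg (m : ℕ) : 0 ≤ harm m := Finset.sum_nonneg fun _ _ => by positivity

lemma harm_mono : Monotone harm := fun a b h =>
  Finset.sum_le_sum_of_subset_of_nonneg (Finset.range_mono h) (fun _ _ _ => by positivity)

lemma norm_z {N : ℕ} (hN : 0 < N) {z : ℂ} (hz : z ^ N = 1) : ‖z‖ = 1 :=
  Complex.norm_eq_one_of_pow_eq_one hz hN.ne'

lemma norm_ltr {a : ℕ} {z : ℂ} (hz : ‖z‖ = 1) (l : ℕ) : ‖ltr a z l‖ = 1 / (l : ℝ) ^ a := by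
  simp [ltr, hz]

lemma norm_ltr_le {a : ℕ} (ha : 0 < a) {z : ℂ} (hz : ‖z‖ = 1) (l : ℕ) :
    ‖ltr a z l‖ ≤ 1 / (l : ℝ) := by
  rw [norm_ltr hz]
  rcases Nat.eq_zero_or_pos l with rfl | h
  · simp [ha.ne']
  · have h1 : (1 : ℝ) ≤ l := by exact_mod_cast h
    exact one_div_le_one_div_of_le (by positivity) (le_self_pow₀ h1 ha.ne')

/-- Transfer of sums. -/
lemma hasSum_cons_iff {n : ℕ} {E : Type*} [AddCommMonoid E] [TopologicalSpace E]
    (F : (Fin (n + 1) → ℕ) → E) (x : E) :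
    HasSum F x ↔ HasSum (fun p : ℕ × (Fin n → ℕ) => F (Fin.cons p.1 p.2)) x :=
  ((Fin.consEquiv (fun _ : Fin (n + 1) => ℕ)).hasSum_iff (f := F)).symm

lemma hasSum_UU_cons {E : Type*} [NormedAddCommGroup E] {n : ℕ}
    (F : (Fin (n + 1) → ℕ) → E) (hF : (Function.support F).Finite) (m : ℕ) (u : ℕ → E)
    (h0 : ∀ l g, ¬ l < m → F (Fin.cons l g) = 0)
    (h1 : ∀ l, l < m → HasSum (fun g => F (Fin.cons l g)) (u l)) :
    HasSum F (∑ l ∈ Finset.range m, u l) := by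
  have hs : Summable F := summable_of_hasFiniteSupport hF
  obtain ⟨x, hx⟩ := hs
  have hx' := (hasSum_cons_iff F x).1 hx
  have h3 := HasSum.prod_fiberwise (g := fun l => if l < m then u l else 0) hx' (fun l => by
    by_cases h : l < m
    · simpa [h] using h1 l h
    · simp only [h, if_false]
      simp only [h0 l _ h]
      exact hasSum_zero)
  have h4 : HasSum (fun l => if l < m then u l else 0) (∑ l ∈ Finset.range m, u l) := by
    have := hasSum_sum_of_ne_finset_zero (f := fun l => if l < m then u l else 0)
      (s := Finset.range m) (L := SummationFilter.unconditional ℕ) (fun b hb => by simp at hb; simp [hb])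
    rwa [Finset.sum_congr rfl (g := u) (fun l hl => by simp [Finset.mem_range.1 hl])] at this
  rw [h4.unique h3]
  exact hx

lemma Gen.exists_word {N : ℕ} (hN : 0 < N) {k : ℕ} {f : ℕ → ℂ} (h : Gen N k f) :
    ∃ (n : ℕ) (a : Fin n → ℕ) (z : Fin n → ℂ), (∀ j, 0 < a j) ∧ (∀ j, z j ^ N = 1) ∧
      (∑ j, a j = k) ∧ (∀ m, HasSum (UU a z m) (f m)) ∧
      ∃ F : ℕ → ℝ, (∀ m, HasSum (fun g => ‖UU a z m g‖) (F m)) ∧ (∀ m, 0 ≤ F m) ∧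
        ∀ m, F m ≤ harm m ^ n := by
  induction h with
  | one =>
    refine ⟨0, Fin.elim0, Fin.elim0, fun j => j.elim0, fun j => j.elim0, by simp, fun m => ?_,
      fun _ => 1, fun m => ?_, fun _ => zero_le_one, fun m => by simp⟩
    · have := hasSum_unique (UU (Fin.elim0 : Fin 0 → ℕ) Fin.elim0 m)
      convert this using 1
      simp [UU, Subsingleton.strictAnti]
    · have := hasSum_unique (fun g => ‖UU (Fin.elim0 : Fin 0 → ℕ) Fin.elim0 m g‖)
      convert this using 1
      simp [UU, Subsingleton.strictAnti]
  | cons a0 k z0 f ha hz hf ih =>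
    obtain ⟨n, a, z, h1, h2, h3, h4, F, h5, h6, h7⟩ := ih
    refine ⟨n + 1, Fin.cons a0 a, Fin.cons z0 z, ?_, ?_, ?_, fun m => ?_,
      fun m => ∑ l ∈ Finset.range m, ‖ltr a0 z0 l‖ * F l, fun m => ?_, fun m => ?_, fun m => ?_⟩
    · intro j; induction j using Fin.cases <;> simp [ha, h1]
    · intro j; induction j using Fin.cases <;> simp [hz, h2]
    · simp [Fin.sum_univ_succ, h3]
    · rw [Iop_apply]
      refine hasSum_UU_cons _ (UU_support _ _ _) m _ ?_ ?_
      · intro l g hl; rw [UU_cons, if_neg hl]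
      · intro l hl
        simp only [UU_cons, if_pos hl]
        exact (h4 l).mul_left _
    · refine hasSum_UU_cons _ ?_ m _ ?_ ?_
      · refine (UU_support (Fin.cons a0 a) (Fin.cons z0 z) m).subset ?_
        intro g hg hg'
        apply hg
        simp [hg']
      · intro l g hl; rw [UU_cons, if_neg hl, norm_zero]
      · intro l hl
        simp only [UU_cons, if_pos hl, norm_mul]
        exact (h5 l).mul_left _
    · exact Finset.sum_nonneg fun l _ => mul_nonneg (norm_nonneg _) (h6 l)
    · rw [pow_succ', harm, Finset.sum_mul]
      refine Finset.sum_le_sum fun l hl => ?_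
      refine mul_le_mul (norm_ltr_le ha (norm_z hN hz) l) ?_ (h6 l) (by positivity)
      refine (h7 l).trans (pow_le_pow_left₀ (harm_nonneg l) ?_ n)
      exact harm_mono (Finset.mem_range.1 hl).le

lemma summable_harm (n : ℕ) (a : ℕ) (ha : 2 ≤ a) :
    Summable fun l : ℕ => 1 / (l : ℝ) ^ a * harm l ^ n := by
  have hb : ∀ l : ℕ, 1 ≤ l → harm l ≤ 1 + Real.log l := by
    intro l hl
    obtain ⟨l, rfl⟩ : ∃ j, l = j + 1 := ⟨l - 1, by omega⟩
    have h2 : harm (l + 1) = ((harmonic l : ℚ) : ℝ) := by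
      unfold harm harmonic
      rw [Finset.sum_range_succ']
      simp
    rw [h2]
    refine (harmonic_le_one_add_log l).trans ?_
    rcases Nat.eq_zero_or_pos l with rfl | h
    · simp
    · have h0 : (0 : ℝ) < l := by exact_mod_cast h
      have := Real.log_le_log h0 (show (l : ℝ) ≤ ((l + 1 : ℕ) : ℝ) by push_cast; linarith)
      linarith
  set e : ℝ := 1 / (2 * (n + 1)) with he
  have he0 : 0 < e := by positivity
  have hen : e * n ≤ 1 / 2 := by
    rw [he, div_mul_eq_mul_div, div_le_div_iff₀ (by positivity) (by positivity)]
    linarith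
  have hs : Summable fun l : ℕ => (1 + 1 / e) ^ n * (1 / (l : ℝ) ^ (3 / 2 : ℝ)) :=
    (Real.summable_one_div_nat_rpow.2 (by norm_num)).mul_left _
  refine Summable.of_nonneg_of_le
    (fun l => mul_nonneg (by positivity) (pow_nonneg (harm_nonneg l) n)) (fun l => ?_) hs
  rcases Nat.eq_zero_or_pos l with rfl | h
  · have : a ≠ 0 := by omega
    simp [this]
  · have h1 : (1 : ℝ) ≤ l := by exact_mod_cast h
    have hx0 : (0 : ℝ) < l := by linarith
    have hle : harm l ≤ (1 + 1 / e) * (l : ℝ) ^ e := by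
      have h3 := Real.log_le_rpow_div hx0.le he0
      have h4 : (1 : ℝ) ≤ (l : ℝ) ^ e := Real.one_le_rpow h1 he0.le
      have h5 := hb l h
      have h6 : (1 + 1 / e) * (l : ℝ) ^ e = (l : ℝ) ^ e + (l : ℝ) ^ e / e := by ring
      linarith
    have hpow : harm l ^ n ≤ (1 + 1 / e) ^ n * (l : ℝ) ^ (1 / 2 : ℝ) := by
      refine (pow_le_pow_left₀ (harm_nonneg l) hle n).trans ?_
      rw [mul_pow, ← Real.rpow_mul_natCast hx0.le]
      exact mul_le_mul_of_nonneg_left (Real.rpow_le_rpow_of_exponent_le h1 hen) (by positivity)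
    have hl2 : 1 / (l : ℝ) ^ a ≤ 1 / (l : ℝ) ^ 2 :=
      one_div_le_one_div_of_le (by positivity) (pow_le_pow_right₀ h1 ha)
    refine (mul_le_mul hl2 hpow (pow_nonneg (harm_nonneg l) n) (by positivity)).trans (le_of_eq ?_)
    have h7 : (l : ℝ) ^ 2 = (l : ℝ) ^ (1 / 2 : ℝ) * (l : ℝ) ^ (3 / 2 : ℝ) := by
      rw [← Real.rpow_add hx0, ← Real.rpow_natCast]
      norm_num
    rw [h7]
    have h8 : (l : ℝ) ^ (1 / 2 : ℝ) ≠ 0 := (Real.rpow_pos_of_pos hx0 _).ne'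
    field_simp

lemma Gen.hasSum {N : ℕ} (hN : 0 < N) {k : ℕ} {f : ℕ → ℂ} (h : Gen N k f) (a0 : ℕ)
    (ha0 : 2 ≤ a0) (z0 : ℂ) (hz0 : z0 ^ N = 1) :
    ∃ x ∈ zspan (a0 + k) N, HasSum (fun m => ltr a0 z0 m * f m) x := by
  obtain ⟨n, a, z, h1, h2, h3, h4, F, h5, h6, h7⟩ := h.exists_word hN
  have ha : ∀ j, 0 < (Fin.cons a0 a : Fin (n + 1) → ℕ) j := by
    intro j; induction j using Fin.cases <;> simp [h1]; omega
  refine ⟨MPL (Fin.cons a0 a) (Fin.cons z0 z), Submodule.subset_span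
    ⟨n, Fin.cons a0 a, Fin.cons z0 z, ha, ?_, ?_, ?_, rfl⟩, ?_⟩
  · intro j; induction j using Fin.cases <;> simp [hz0, h2]
  · simp [Fin.sum_univ_succ, h3]
  · rintro ⟨h, -⟩
    simp at h; omega
  · have hS : Summable fun p : ℕ × (Fin n → ℕ) =>
        VV (Fin.cons a0 a) (Fin.cons z0 z) (Fin.cons p.1 p.2) := by
      apply Summable.of_norm
      simp only [VV_cons, norm_mul]
      rw [summable_prod_of_nonneg (fun _ => mul_nonneg (norm_nonneg _) (norm_nonneg _))]
      dsimp only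
      refine ⟨fun l => ((h5 l).mul_left _).summable, ?_⟩
      simp only [fun l => ((h5 l).mul_left ‖ltr a0 z0 l‖).tsum_eq]
      refine Summable.of_nonneg_of_le (fun l => mul_nonneg (norm_nonneg _) (h6 l)) (fun l => ?_)
        (summable_harm n a0 ha0)
      rw [norm_ltr (norm_z hN hz0)]
      exact mul_le_mul_of_nonneg_left (h7 l) (by positivity)
    obtain ⟨x, hx⟩ := hS
    have hx2 := (hasSum_cons_iff _ x).2 hx
    rw [MPL_eq _ _ ha, hx2.tsum_eq]
    simp only [VV_cons] at hx
    have h8 : ∀ l, HasSum (fun g => ltr a0 z0 l * UU a z l g) (ltr a0 z0 l * f l) :=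
      fun l => (h4 l).mul_left _
    exact HasSum.prod_fiberwise
      (f := fun p : ℕ × (Fin n → ℕ) => ltr a0 z0 p.1 * UU a z p.1 p.2)
      (g := fun l => ltr a0 z0 l * f l) hx h8

lemma TT.hasSum {N : ℕ} (hN : 0 < N) {k : ℕ} {f : ℕ → ℂ} (h : f ∈ TT N k) (a0 : ℕ)
    (ha0 : 2 ≤ a0) (z0 : ℂ) (hz0 : z0 ^ N = 1) :
    ∃ x ∈ zspan (a0 + k) N, HasSum (fun m => ltr a0 z0 m * f m) x := by
  induction h using Submodule.span_induction with
  | mem f hf => exact Gen.hasSum hN hf a0 ha0 z0 hz0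
  | zero => exact ⟨0, Submodule.zero_mem _, by simpa using hasSum_zero⟩
  | add f g _ _ hf hg =>
    obtain ⟨x, hx, hx'⟩ := hf
    obtain ⟨y, hy, hy'⟩ := hg
    refine ⟨x + y, Submodule.add_mem _ hx hy, ?_⟩
    simpa [mul_add] using hx'.add hy'
  | smul c f _ hf =>
    obtain ⟨x, hx, hx'⟩ := hf
    refine ⟨c • x, Submodule.smul_mem _ c hx, ?_⟩
    simpa using hx'.const_smul c

lemma TT.Iop_mem {N k : ℕ} {f : ℕ → ℂ} (h : f ∈ TT N k) (a : ℕ) (ha : 0 < a) (z : ℂ)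
    (hz : z ^ N = 1) : Iop a z f ∈ TT N (a + k) := by
  induction h using Submodule.span_induction with
  | mem f hf => exact Submodule.subset_span (Gen.cons a k z f ha hz hf)
  | zero => simp
  | add f g _ _ hf hg => rw [map_add]; exact Submodule.add_mem _ hf hg
  | smul c f _ hf => rw [map_smul]; exact Submodule.smul_mem _ c hf

lemma Iop_mul (a b : ℕ) (z y : ℂ) (f : ℕ → ℂ) :
    Iop a z 1 * Iop b y f =
      Iop a z (Iop b y f) + Iop b y (Iop a z 1 * f) + Iop (a + b) (z * y) f := by
  ext m
  simp only [Pi.mul_apply, Pi.add_apply]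
  induction m with
  | zero => simp [Iop_apply]
  | succ m ih =>
    have key : ∀ c w g, Iop c w g (m + 1) = Iop c w g m + ltr c w m * g m := fun c w g => by
      simp [Iop_apply, Finset.sum_range_succ]
    have hl : ltr (a + b) (z * y) m = ltr a z m * ltr b y m := by
      simp only [ltr, mul_pow, pow_add]
      rw [div_mul_div_comm]
    simp only [key, hl, Pi.mul_apply, Pi.one_apply]
    linear_combination ih

lemma Gen.mul_mem {N k : ℕ} {f : ℕ → ℂ} (h : Gen N k f) (a : ℕ) (ha : 0 < a) (z : ℂ)
    (hz : z ^ N = 1) : Iop a z 1 * f ∈ TT N (a + k) := by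
  induction h with
  | one =>
    rw [mul_one]
    exact Submodule.subset_span (Gen.cons a 0 z 1 ha hz Gen.one)
  | cons b k y f hb hy hf ih =>
    rw [Iop_mul]
    refine Submodule.add_mem _ (Submodule.add_mem _ ?_ ?_) ?_
    · exact Submodule.subset_span (Gen.cons _ _ _ _ ha hz (Gen.cons _ _ _ _ hb hy hf))
    · have := TT.Iop_mem ih b hb y hy
      rwa [show b + (a + k) = a + (b + k) by omega] at this
    · rw [← add_assoc]
      exact Submodule.subset_span (Gen.cons _ _ _ _ (by omega) (by rw [mul_pow, hz, hy, one_mul]) hf)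

lemma TT.mul_mem {N k : ℕ} {f : ℕ → ℂ} (h : f ∈ TT N k) (a : ℕ) (ha : 0 < a) (z : ℂ)
    (hz : z ^ N = 1) : Iop a z 1 * f ∈ TT N (a + k) := by
  induction h using Submodule.span_induction with
  | mem f hf => exact Gen.mul_mem hf a ha z hz
  | zero => simp
  | add f g _ _ hf hg => rw [mul_add]; exact Submodule.add_mem _ hf hg
  | smul c f _ hf => rw [mul_smul_comm]; exact Submodule.smul_mem _ c hf

/-- Even harmonic function. -/
def fe (r : ℕ) : ℕ → ℂ := ((2 : ℚ) ^ r / 2) • (Iop r 1 1 + Iop r (-1) 1)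

def fo (r : ℕ) : ℕ → ℂ := Iop r 1 1 - Iop r (-1) 1

lemma fe_mul {N k r : ℕ} (hN : (-1 : ℂ) ^ N = 1) {f : ℕ → ℂ} (h : f ∈ TT N k) (hr : 0 < r) :
    fe r * f ∈ TT N (r + k) := by
  rw [fe, smul_mul_assoc, add_mul]
  exact Submodule.smul_mem _ _ (Submodule.add_mem _ (TT.mul_mem h r hr _ (one_pow _))
    (TT.mul_mem h r hr _ hN))

lemma fo_mul {N k r : ℕ} (hN : (-1 : ℂ) ^ N = 1) {f : ℕ → ℂ} (h : f ∈ TT N k) (hr : 0 < r) :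
    fo r * f ∈ TT N (r + k) := by
  rw [fo, sub_mul]
  exact (Submodule.sub_mem _ (TT.mul_mem h r hr _ (one_pow _))
    (TT.mul_mem h r hr _ hN))

lemma fprod_mem {N : ℕ} (F : ℕ → ℕ → ℂ)
    (hF : ∀ k r f, f ∈ TT N k → 0 < r → F r * f ∈ TT N (r + k)) (k : ℕ) (f : ℕ → ℂ)
    (hf : f ∈ TT N k) :
    ∀ (M : ℕ) (r : Fin M → ℕ) (_ : ∀ j, 0 < r j), (∏ j, F (r j)) * f ∈ TT N ((∑ j, r j) + k) := by
  intro M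
  induction M with
  | zero => intro r _; simpa using hf
  | succ M ih =>
    intro r hr
    rw [Fin.prod_univ_succ, Fin.sum_univ_succ, mul_assoc, add_assoc]
    exact hF _ _ _ (ih _ (fun j => hr _)) (hr 0)

lemma fe_apply (r n : ℕ) (hr : 0 < r) : fe r (2 * n + 2) = (H r n : ℂ) := by
  induction n with
  | zero => simp [fe, H, Iop_apply, Finset.sum_range_succ, ltr, hr.ne']
  | succ n ih =>
    have key : ∀ c w g m, Iop c w g (m + 1) = Iop c w g m + ltr c w m * g m := fun c w g m => by
      simp [Iop_apply, Finset.sum_range_succ]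
    have hH : H r (n + 1) = H r n + 1 / (n + 1) ^ r := by simp [H, Finset.sum_range_succ]
    rw [hH]
    push_cast
    rw [← ih, show 2 * (n + 1) + 2 = 2 * n + 2 + 1 + 1 by ring]
    simp only [fe, Pi.smul_apply, Pi.add_apply, key, Pi.one_apply, Rat.smul_def, ltr]
    have e1 : (-1 : ℂ) ^ (2 * n + 2) = 1 := by rw [show 2 * n + 2 = 2 * (n + 1) by ring, pow_mul]; simp
    have e2 : (-1 : ℂ) ^ (2 * n + 2 + 1) = -1 := by rw [pow_succ, e1]; simp
    rw [e1, e2]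
    push_cast
    have e3 : (2 * (n : ℂ) + 2) ^ r = 2 ^ r * ((n : ℂ) + 1) ^ r := by rw [← mul_pow]; ring
    rw [e3]
    have : ((n : ℂ) + 1) ≠ 0 := by exact_mod_cast Nat.succ_ne_zero n
    have h3 : 2 * (n : ℂ) + 2 + 1 ≠ 0 := by exact_mod_cast Nat.succ_ne_zero (2 * n + 2)
    field_simp
    ring

lemma fo_apply (r n : ℕ) (hr : 0 < r) :
    fo r (2 * n + 2) = (H r (2 * n + 1) : ℂ) + (Hbar r (2 * n + 1) : ℂ) := by
  simp only [fo, Pi.sub_apply, Iop_apply, H, Hbar, ltr, Pi.one_apply, mul_one]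
  rw [Finset.sum_range_succ' _ (2 * n + 1), Finset.sum_range_succ' _ (2 * n + 1)]
  push_cast
  rw [add_sub_add_comm, ← Finset.sum_sub_distrib, ← Finset.sum_add_distrib]
  simp only [pow_zero, sub_self, add_zero]
  refine Finset.sum_congr rfl fun l _ => ?_
  rw [one_pow, pow_succ]
  ring

/-- The combined product. -/
lemma main_mem {N : ℕ} (hN : (-1 : ℂ) ^ N = 1) (M M' : ℕ) (r : Fin M → ℕ) (hr : ∀ j, 0 < r j)
    (r' : Fin M' → ℕ) (hr' : ∀ j, 0 < r' j) :
    ∃ F ∈ TT N ((∑ j, r j) + ∑ j', r' j'), ∀ n, F (2 * n + 2) = (∏ j, (H (r j) n : ℂ)) *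
        (∏ j', ((H (r' j') (2 * n + 1) : ℂ) + (Hbar (r' j') (2 * n + 1) : ℂ))) := by
  refine ⟨(∏ j, fe (r j)) * ((∏ j, fo (r' j)) * 1), ?_, fun n => ?_⟩
  · refine fprod_mem fe (fun k r f h h' => fe_mul hN h h') _ _ ?_ M r hr
    have := fprod_mem fo (fun k r f h h' => fo_mul hN h h') 0 1
      (Submodule.subset_span Gen.one) M' r' hr'
    simpa using this
  · simp only [Pi.mul_apply, Finset.prod_apply, Pi.one_apply, mul_one]
    congr 1
    · exact Finset.prod_congr rfl fun j _ => fe_apply _ _ (hr j)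
    · exact Finset.prod_congr rfl fun j _ => fo_apply _ _ (hr' j)

/-- Extraction of the even part. -/
lemma even_part {N k : ℕ} (hN : 0 < N) (hN1 : (-1 : ℂ) ^ N = 1) (z : ℂ) (hz : z ^ N = 1)
    {F : ℕ → ℂ} (hF : F ∈ TT N k) (a : ℕ) (ha : 2 ≤ a) :
    ∑' n : ℕ, z ^ (2 * n + 2) * F (2 * n + 2) / ((n : ℂ) + 1) ^ a ∈ zspan (a + k) N := by
  obtain ⟨x, hx, hx'⟩ := TT.hasSum hN hF a ha z hz
  obtain ⟨y, hy, hy'⟩ := TT.hasSum hN hF a ha (-z) (by rw [neg_pow, hN1, hz, one_mul])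
  have hs := (hx'.add hy').const_smul ((2 : ℚ) ^ a / 2)
  have hmem : ((2 : ℚ) ^ a / 2) • (x + y) ∈ zspan (a + k) N :=
    Submodule.smul_mem _ _ (Submodule.add_mem _ hx hy)
  have hinj : Function.Injective (fun n : ℕ => 2 * n + 2) := fun p q h => by
    simp at h; exact h
  rw [← hinj.hasSum_iff] at hs
  · rw [← hs.tsum_eq] at hmem
    convert hmem using 1
    refine tsum_congr fun n => ?_
    simp only [Function.comp, ltr, Rat.smul_def]
    have e1 : (-z : ℂ) ^ (2 * n + 2) = z ^ (2 * n + 2) := by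
      rw [show 2 * n + 2 = 2 * (n + 1) by ring, pow_mul, pow_mul]; simp
    rw [e1]
    push_cast
    have e3 : (2 * (n : ℂ) + 2) ^ a = 2 ^ a * ((n : ℂ) + 1) ^ a := by rw [← mul_pow]; ring
    rw [e3]
    have : ((n : ℂ) + 1) ≠ 0 := by exact_mod_cast Nat.succ_ne_zero n
    field_simp
    ring
  · intro m hm
    rcases Nat.even_or_odd' m with ⟨c, rfl | rfl⟩
    · rcases c with _ | c
      · have : a ≠ 0 := by omega
        simp [ltr, this]
      · exact absurd ⟨c, by ring⟩ hm
    · have : (-z) ^ (2 * c + 1) = - z ^ (2 * c + 1) := Odd.neg_pow ⟨c, rfl⟩ z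
      simp only [ltr, this]
      rw [neg_div, neg_mul, add_neg_cancel, smul_zero]

lemma H_ge (r n : ℕ) : 1 ≤ H r (n + 1) := by
  unfold H
  rw [Finset.sum_range_succ']
  have : 0 ≤ ∑ k ∈ Finset.range n, (1 : ℝ) / (((k + 1 : ℕ) : ℝ) + 1) ^ r :=
    Finset.sum_nonneg fun _ _ => by positivity
  simpa using this

lemma HH_ge (r n : ℕ) : 1 ≤ H r (n + 1) + Hbar r (n + 1) := by
  unfold H Hbar
  rw [← Finset.sum_add_distrib, Finset.sum_range_succ']
  have : 0 ≤ ∑ k ∈ Finset.range n, ((1 : ℝ) / (((k + 1 : ℕ) : ℝ) + 1) ^ r +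
      (-1) ^ (k + 1) / (((k + 1 : ℕ) : ℝ) + 1) ^ r) := by
    refine Finset.sum_nonneg fun k _ => ?_
    rw [← add_div]
    refine div_nonneg ?_ (by positivity)
    rcases neg_one_pow_eq_or ℝ (k + 1) with h | h <;> rw [h] <;> norm_num
  simp only [Nat.cast_zero, zero_add, one_pow, pow_zero]
  linarith

lemma one_le_norm_prod {M : ℕ} (f : Fin M → ℂ) (h : ∀ j, 1 ≤ ‖f j‖) : 1 ≤ ‖∏ j, f j‖ := by
  rw [norm_prod]
  exact Finset.prod_induction _ (fun x : ℝ => 1 ≤ x)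
    (fun _ _ => one_le_mul_of_one_le_of_one_le) le_rfl (fun j _ => h j)

lemma not_summable_alt (M M' : ℕ) (r : Fin M → ℕ) (r' : Fin M' → ℕ) :
    ¬ Summable (fun n : ℕ => (-1 : ℂ) ^ (n + 1) * (∏ j, (H (r j) n : ℂ)) *
        (∏ j', ((H (r' j') (2 * n + 1) : ℂ) + (Hbar (r' j') (2 * n + 1) : ℂ))) /
        ((n : ℂ) + 1) ^ (0 + 1)) := by
  intro hs
  have h1 := (summable_nat_add_iff 1).2 hs.norm
  have h2 : Summable fun n : ℕ => (1 : ℝ) / ((n + 2 : ℕ) : ℝ) := by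
    refine Summable.of_nonneg_of_le (fun n => by positivity) (fun n => ?_) h1
    rw [norm_div, norm_mul, norm_mul]
    have e : ‖(((n + 1 : ℕ) : ℂ) + 1) ^ (0 + 1)‖ = ((n + 2 : ℕ) : ℝ) := by
      rw [zero_add, pow_one, show (((n + 1 : ℕ) : ℂ) + 1) = ((n + 2 : ℕ) : ℂ) by push_cast; ring]
      exact Complex.norm_natCast _
    rw [e]
    refine div_le_div_of_nonneg_right ?_ (by positivity)
    rw [norm_pow, norm_neg, norm_one, one_pow, one_mul]
    refine one_le_mul_of_one_le_of_one_le (one_le_norm_prod _ fun j => ?_)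
      (one_le_norm_prod _ fun j => ?_)
    · rw [Complex.norm_real]
      exact (H_ge _ _).trans (le_abs_self _)
    · rw [← Complex.ofReal_add, Complex.norm_real]
      exact (HH_ge _ _).trans (le_abs_self _)
  exact Real.not_summable_one_div_natCast ((summable_nat_add_iff 2).1 h2)

/-- Even-denominator variants of odd-variable Euler sums: for nonnegative `M, M′, s`,
positive `r_j, r′_{j′}`, `k = s + ∑ r_j + ∑ r′_{j′}`,
`∑_{n=1}^∞ (∏_j H_{n-1}^{(r_j)}) (∏_{j′} (H_{2n-1}^{(r′_{j′})} + H̄_{2n-1}^{(r′_{j′})}))/n^{s+2}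
  ∈ 𝔷_{k+2}(2)` and the alternating version with `(-1)^n/n^{s+1}` lies in `𝔷_{k+1}(4)`. -/
theorem odd_euler_sums_even_denominator (M M' : ℕ) (r : Fin M → ℕ) (hr : ∀ j, 0 < r j)
    (r' : Fin M' → ℕ) (hr' : ∀ j, 0 < r' j) (s : ℕ) :
    (∑' n : ℕ, (∏ j, (H (r j) n : ℂ)) *
        (∏ j', ((H (r' j') (2 * n + 1) : ℂ) + (Hbar (r' j') (2 * n + 1) : ℂ))) /
        ((n : ℂ) + 1) ^ (s + 2) ∈
      zspan (s + (∑ j, r j) + (∑ j', r' j') + 2) 2) ∧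
    (∑' n : ℕ, (-1 : ℂ) ^ (n + 1) * (∏ j, (H (r j) n : ℂ)) *
        (∏ j', ((H (r' j') (2 * n + 1) : ℂ) + (Hbar (r' j') (2 * n + 1) : ℂ))) /
        ((n : ℂ) + 1) ^ (s + 1) ∈
      zspan (s + (∑ j, r j) + (∑ j', r' j') + 1) 4) := by
  constructor
  · obtain ⟨F, hF, hF'⟩ := main_mem (N := 2) (by norm_num) M M' r hr r' hr'
    have := even_part (N := 2) two_pos (by norm_num) 1 (one_pow _) hF (s + 2) (by omega)
    rw [show s + 2 + (∑ j, r j + ∑ j', r' j') = s + (∑ j, r j) + (∑ j', r' j') + 2 by ring] at this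
    simpa only [hF', one_pow, one_mul] using this
  · rcases s with _ | s
    · rw [tsum_eq_zero_of_not_summable (not_summable_alt M M' r r')]
      exact Submodule.zero_mem _
    · obtain ⟨F, hF, hF'⟩ := main_mem (N := 4) (by norm_num) M M' r hr r' hr'
      have := even_part (N := 4) four_pos (by norm_num) Complex.I Complex.I_pow_four hF
        (s + 1 + 1) (by omega)
      rw [show s + 1 + 1 + (∑ j, r j + ∑ j', r' j') =
        s + 1 + (∑ j, r j) + (∑ j', r' j') + 1 by ring] at this
      have e : ∀ n : ℕ, Complex.I ^ (2 * n + 2) = (-1) ^ (n + 1) := fun n => by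
        rw [show 2 * n + 2 = 2 * (n + 1) by ring, pow_mul, Complex.I_sq]
      simp only [hF', e, ← mul_assoc] at this
      exact this
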